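/- (Theorem 1, convergence of graph trend collaborative filtering.) Let m, n, d be positive natural numbers, let M be a real m×n matrix satisfying ‖M Mᵀ‖₂ ≤ 2 (as holds for the degree-normalized incidence matrix of a finite simple graph), let X be a real n×d matrix, and let λ ≥ 0. Starting from any Y⁰ ∈ ℝ^{m×d}, define for each k ≥ 0 the iterates: Ē^{k+1} = X − Mᵀ Y^k; Ȳ^{k+1} = Y^k + (1/2)·M Ē^{k+1}; Y^{k+1}_{ij} = sign(Ȳ^{k+1}_{ij})·min(|Ȳ^{k+1}_{ij}|, λ) for all entries (i,j); and E^{k+1} = X − Mᵀ Y^{k+1}. Then the sequence E^k converges (entrywise, equivalently in Frobenius norm) to the unique global minimizer E* of F(E) = (1/2)·‖E − X‖_F² + λ·‖M E‖₁ over ℝ^{n×d}. -/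

import Mathlib

open Filter Matrix

/-- The Frobenius inner product of two real matrices. -/
def frobInner {p q : ℕ} (A B : Matrix (Fin p) (Fin q) ℝ) : ℝ := ∑ i, ∑ j, A i j * B i j

section FrobInner

variable {p q r : ℕ} (A B C : Matrix (Fin p) (Fin q) ℝ)

theorem frobInner_comm : frobInner A B = frobInner B A := by
  simp only [frobInner, mul_comm]

theorem frobInner_add_left : frobInner (A + B) C = frobInner A C + frobInner B C := by
  simp only [frobInner, Matrix.add_apply, add_mul, Finset.sum_add_distrib]

theorem frobInner_sub_left : frobInner (A - B) C = frobInner A C - frobInner B C := by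
  simp only [frobInner, Matrix.sub_apply, sub_mul, Finset.sum_sub_distrib]

theorem frobInner_smul_left (c : ℝ) : frobInner (c • A) B = c * frobInner A B := by
  simp only [frobInner, Matrix.smul_apply, smul_eq_mul, mul_assoc, Finset.mul_sum]

theorem frobInner_sub_right : frobInner A (B - C) = frobInner A B - frobInner A C := by
  rw [frobInner_comm, frobInner_sub_left, frobInner_comm B, frobInner_comm C]

theorem frobInner_smul_right (c : ℝ) : frobInner A (c • B) = c * frobInner A B := by
  rw [frobInner_comm, frobInner_smul_left, frobInner_comm]

theorem frobInner_self_nonneg : 0 ≤ frobInner A A :=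
  Finset.sum_nonneg fun _ _ => Finset.sum_nonneg fun _ _ => mul_self_nonneg _

theorem sq_apply_le_frobInner_self (i : Fin p) (j : Fin q) : A i j ^ 2 ≤ frobInner A A := by
  rw [sq]
  exact (Finset.single_le_sum (f := fun j => A i j * A i j)
    (fun _ _ => mul_self_nonneg _) (Finset.mem_univ j)).trans
    (Finset.single_le_sum (f := fun i => ∑ j, A i j * A i j)
      (fun _ _ => Finset.sum_nonneg fun _ _ => mul_self_nonneg _) (Finset.mem_univ i))

theorem frobInner_eq_trace : frobInner A B = (Aᵀ * B).trace := by
  simp only [frobInner, Matrix.trace, Matrix.diag, Matrix.mul_apply, Matrix.transpose_apply]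
  exact Finset.sum_comm

theorem frobInner_transpose_mul (M : Matrix (Fin r) (Fin p) ℝ) (W : Matrix (Fin r) (Fin q) ℝ) :
    frobInner (Mᵀ * W) A = frobInner W (M * A) := by
  simp only [frobInner_eq_trace, Matrix.transpose_mul, Matrix.transpose_transpose,
    Matrix.mul_assoc]

theorem frobInner_transpose_mul_self_le (M : Matrix (Fin p) (Fin r) ℝ) {c : ℝ}
    (hM : ∀ x : Fin p → ℝ, x ⬝ᵥ ((M * Mᵀ).mulVec x) ≤ c * (x ⬝ᵥ x)) :
    frobInner (Mᵀ * A) (Mᵀ * A) ≤ c * frobInner A A := by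
  rw [frobInner_transpose_mul, ← Matrix.mul_assoc]
  simp only [frobInner]
  rw [Finset.sum_comm, Finset.sum_comm (f := fun i j => A i j * A i j), Finset.mul_sum]
  exact Finset.sum_le_sum fun j _ => hM fun i => A i j

theorem frobInner_le_of_abs_le {c : ℝ} (hB : ∀ i j, |B i j| ≤ c) :
    frobInner A B ≤ c * ∑ i, ∑ j, |A i j| := by
  simp only [frobInner, Finset.mul_sum]
  refine Finset.sum_le_sum fun i _ => Finset.sum_le_sum fun j _ => ?_
  calc A i j * B i j ≤ |A i j| * |B i j| := by rw [← abs_mul]; exact le_abs_self _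
    _ ≤ |A i j| * c := mul_le_mul_of_nonneg_left (hB i j) (abs_nonneg _)
    _ = c * |A i j| := mul_comm _ _

end FrobInner

theorem abs_sign_mul_min_le {c : ℝ} (hc : 0 ≤ c) (y : ℝ) :
    |Real.sign y * min |y| c| ≤ c := by
  have h0 : 0 ≤ min |y| c := le_min (abs_nonneg y) hc
  have h1 : min |y| c ≤ c := min_le_right _ _
  rcases lt_trichotomy y 0 with h | h | h
  · rw [Real.sign_of_neg h, neg_one_mul, abs_neg, abs_of_nonneg h0]; exact h1
  · simp [h, hc]
  · rw [Real.sign_of_pos h, one_mul, abs_of_nonneg h0]; exact h1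

/-- `sign y * min |y| c` is the projection of `y` onto `[-c, c]`. -/
theorem sub_sign_mul_min_mul_nonpos {c z : ℝ} (hz : |z| ≤ c) (y : ℝ) :
    (y - Real.sign y * min |y| c) * (z - Real.sign y * min |y| c) ≤ 0 := by
  obtain ⟨hz1, hz2⟩ := abs_le.1 hz
  rcases lt_trichotomy y 0 with h | h | h
  · rw [Real.sign_of_neg h, abs_of_neg h]
    rcases min_cases (-y) c with ⟨h1, h2⟩ | ⟨h1, h2⟩ <;> rw [h1] <;> nlinarith
  · have hc : 0 ≤ c := (abs_nonneg z).trans hz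
    simp [h]
  · rw [Real.sign_of_pos h, abs_of_pos h]
    rcases min_cases y c with ⟨h1, h2⟩ | ⟨h1, h2⟩ <;> rw [h1] <;> nlinarith

theorem nonneg_of_forall_mul_add_sq_mul_nonneg {a b : ℝ}
    (h : ∀ t : ℝ, 0 < t → t ≤ 1 → 0 ≤ t * a + t ^ 2 * b) : 0 ≤ a := by
  by_contra! ha
  have hab : 0 < |b| - a := by linarith [abs_nonneg b]
  have key := h (-a / (2 * (|b| - a))) (div_pos (by linarith) (by linarith))
    ((div_le_one (by linarith)).2 (by linarith [abs_nonneg b]))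
  set t := -a / (2 * (|b| - a)) with ht
  have htpos : 0 < t := div_pos (by linarith) (by linarith)
  have h1 : t * (2 * (|b| - a)) = -a := div_mul_cancel₀ _ (by linarith)
  have h2 : 0 ≤ a + t * b := by
    refine nonneg_of_mul_nonneg_right (a := t) ?_ htpos
    linarith [key, show t * (a + t * b) = t * a + t ^ 2 * b by ring]
  have h3 : t * b ≤ t * |b| := mul_le_mul_of_nonneg_left (le_abs_self b) htpos.le
  nlinarith

/-- The dual problem of minimizing `‖X - Mᵀ Y‖²` over the box `|Y i j| ≤ c` has a solution,
characterized by its variational inequality. -/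
theorem exists_dual_solution {m n d : ℕ} (M : Matrix (Fin m) (Fin n) ℝ)
    (X : Matrix (Fin n) (Fin d) ℝ) {c : ℝ} (hc : 0 ≤ c) :
    ∃ Y : Matrix (Fin m) (Fin d) ℝ, (∀ i j, |Y i j| ≤ c) ∧
      ∀ Z : Matrix (Fin m) (Fin d) ℝ, (∀ i j, |Z i j| ≤ c) →
        frobInner (M * (X - Mᵀ * Y)) Z ≤ frobInner (M * (X - Mᵀ * Y)) Y := by
  let K : Set (Matrix (Fin m) (Fin d) ℝ) :=
    Set.univ.pi fun _ => Set.univ.pi fun _ => Set.Icc (-c) c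
  have memK : ∀ Z, Z ∈ K ↔ ∀ i j, |Z i j| ≤ c := fun Z =>
    ⟨fun h i j => abs_le.2 (h i trivial j trivial), fun h i _ j _ => abs_le.1 (h i j)⟩
  have hK : IsCompact K := isCompact_univ_pi fun _ => isCompact_univ_pi fun _ => isCompact_Icc
  have hne : K.Nonempty := ⟨0, (memK 0).2 fun i j => by simpa using hc⟩
  let f : Matrix (Fin m) (Fin d) ℝ → ℝ := fun Y => frobInner (X - Mᵀ * Y) (X - Mᵀ * Y)
  have hf : Continuous f := by
    have h : Continuous fun Y : Matrix (Fin m) (Fin d) ℝ => X - Mᵀ * Y := by fun_prop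
    exact continuous_finsetSum _ fun i _ => continuous_finsetSum _ fun j _ =>
      (h.matrix_elem i j).mul (h.matrix_elem i j)
  obtain ⟨Y, hYK, hmin⟩ := hK.exists_isMinOn hne hf.continuousOn
  have hYb := (memK Y).1 hYK
  refine ⟨Y, hYb, fun Z hZ => ?_⟩
  suffices h : 0 ≤ 2 * (frobInner (M * (X - Mᵀ * Y)) Y - frobInner (M * (X - Mᵀ * Y)) Z) by
    linarith
  refine nonneg_of_forall_mul_add_sq_mul_nonneg
    (b := frobInner (Mᵀ * (Z - Y)) (Mᵀ * (Z - Y))) fun t ht0 ht1 => ?_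
  have hmem : Y + t • (Z - Y) ∈ K := by
    refine (memK _).2 fun i j => abs_le.2 ?_
    obtain ⟨h1, h2⟩ := abs_le.1 (hYb i j)
    obtain ⟨h3, h4⟩ := abs_le.1 (hZ i j)
    simp only [Matrix.add_apply, Matrix.smul_apply, Matrix.sub_apply, smul_eq_mul]
    constructor <;> nlinarith
  have hle : f Y ≤ f (Y + t • (Z - Y)) := hmin hmem
  have hres : X - Mᵀ * (Y + t • (Z - Y)) = (X - Mᵀ * Y) - t • (Mᵀ * (Z - Y)) := by
    rw [Matrix.mul_add, Matrix.mul_smul, sub_add_eq_sub_sub]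
  simp only [f, hres] at hle
  have hadj : frobInner (Mᵀ * (Z - Y)) (X - Mᵀ * Y) =
      frobInner (M * (X - Mᵀ * Y)) Z - frobInner (M * (X - Mᵀ * Y)) Y := by
    rw [frobInner_transpose_mul, frobInner_comm, frobInner_sub_right]
  generalize X - Mᵀ * Y = R at *
  generalize Mᵀ * (Z - Y) = S at *
  simp only [frobInner_sub_left, frobInner_sub_right, frobInner_smul_left,
    frobInner_smul_right] at hle
  rw [frobInner_comm R S, hadj] at hle
  linarith

/-- A dual solution yields a primal minimizer with quadratic growth. -/
theorem primal_quadratic_growth {m n d : ℕ} (M : Matrix (Fin m) (Fin n) ℝ)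
    (X : Matrix (Fin n) (Fin d) ℝ) {c : ℝ} (hc : 0 ≤ c)
    {Y : Matrix (Fin m) (Fin d) ℝ} (hY : ∀ i j, |Y i j| ≤ c)
    {E : Matrix (Fin n) (Fin d) ℝ} (hE : E = X - Mᵀ * Y)
    (hvar : ∀ Z : Matrix (Fin m) (Fin d) ℝ, (∀ i j, |Z i j| ≤ c) →
      frobInner (M * E) Z ≤ frobInner (M * E) Y) (E' : Matrix (Fin n) (Fin d) ℝ) :
    1 / 2 * frobInner (E - X) (E - X) + c * ∑ i, ∑ j, |(M * E) i j| +
        1 / 2 * frobInner (E' - E) (E' - E) ≤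
      1 / 2 * frobInner (E' - X) (E' - X) + c * ∑ i, ∑ j, |(M * E') i j| := by
  have hsign : c * ∑ i, ∑ j, |(M * E) i j| ≤ frobInner (M * E) Y := by
    refine le_trans (le_of_eq ?_) (hvar (fun i j => c * Real.sign ((M * E) i j)) ?_)
    · simp only [frobInner, Finset.mul_sum]
      refine Finset.sum_congr rfl fun i _ => Finset.sum_congr rfl fun j _ => ?_
      rcases lt_trichotomy ((M * E) i j) 0 with h | h | h
      · rw [Real.sign_of_neg h, abs_of_neg h]; ring
      · simp [h]
      · rw [Real.sign_of_pos h, abs_of_pos h]; ring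
    · intro i j
      rcases Real.sign_apply_eq ((M * E) i j) with h | h | h <;> simp [h, hc, abs_of_nonneg hc]
  have hE' := frobInner_le_of_abs_le (M * E') Y hY
  have hadj : ∀ A : Matrix (Fin n) (Fin d) ℝ, frobInner (M * A) Y = frobInner (X - E) A := by
    intro A
    rw [frobInner_comm, ← frobInner_transpose_mul, hE, sub_sub_cancel]
  rw [hadj] at hsign hE'
  simp only [frobInner_sub_left, frobInner_sub_right] at *
  linarith [frobInner_comm X E, frobInner_comm X E', frobInner_comm E E']

/-- One projected gradient step on the dual decreases the squared distance to a dual solution. -/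
theorem dual_step_descent {m n d : ℕ} (M : Matrix (Fin m) (Fin n) ℝ)
    (hM : ∀ x : Fin m → ℝ, x ⬝ᵥ ((M * Mᵀ).mulVec x) ≤ 2 * (x ⬝ᵥ x))
    (X : Matrix (Fin n) (Fin d) ℝ) {Y V S : Matrix (Fin m) (Fin d) ℝ}
    (hproj : frobInner (Y + (1 / 2 : ℝ) • (M * (X - Mᵀ * Y)) - V) (S - V) ≤ 0)
    (hvar : frobInner (M * (X - Mᵀ * S)) V ≤ frobInner (M * (X - Mᵀ * S)) S) :
    frobInner (V - S) (V - S) +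
        1 / 2 * frobInner ((X - Mᵀ * V) - (X - Mᵀ * S)) ((X - Mᵀ * V) - (X - Mᵀ * S)) ≤
      frobInner (Y - S) (Y - S) := by
  have hlip := frobInner_transpose_mul_self_le (Y - V) M hM
  have hnn := frobInner_self_nonneg (Mᵀ * S - Mᵀ * Y)
  have hadj : ∀ (A : Matrix (Fin n) (Fin d) ℝ) (W : Matrix (Fin m) (Fin d) ℝ),
      frobInner (M * A) W = frobInner (Mᵀ * W) A := fun A W => by
    rw [frobInner_transpose_mul, frobInner_comm]
  simp only [frobInner_sub_left, frobInner_add_left, frobInner_smul_left, frobInner_sub_right,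
    hadj, Matrix.mul_sub] at *
  linarith [frobInner_comm V S, frobInner_comm Y S, frobInner_comm Y V,
    frobInner_comm (Mᵀ * V) (Mᵀ * S), frobInner_comm (Mᵀ * Y) (Mᵀ * S),
    frobInner_comm (Mᵀ * Y) (Mᵀ * V), frobInner_comm X (Mᵀ * V), frobInner_comm X (Mᵀ * S),
    frobInner_comm X (Mᵀ * Y)]

/-- If a nonnegative sequence `D` decreases by at least `u k` at each step, where `u` is
nonnegative, then `u` tends to zero. -/
theorem tendsto_zero_of_add_le {D u : ℕ → ℝ} (hD : ∀ k, 0 ≤ D k) (hu : ∀ k, 0 ≤ u k)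
    (h : ∀ k, D (k + 1) + u k ≤ D k) : Tendsto u atTop (nhds 0) := by
  have hanti : Antitone D := antitone_nat_of_succ_le fun k => by linarith [h k, hu k]
  have hlim := tendsto_atTop_ciInf hanti ⟨0, by rintro _ ⟨k, rfl⟩; exact hD k⟩
  have hdiff := hlim.sub ((tendsto_add_atTop_iff_nat 1).2 hlim)
  rw [sub_self] at hdiff
  exact squeeze_zero hu (fun k => by linarith [h k]) hdiff

/-- Theorem 1 (convergence of graph trend collaborative filtering). If `‖M Mᵀ‖₂ ≤ 2`
(expressed via the quadratic form: `xᵀ(M Mᵀ)x ≤ 2‖x‖²` for all `x`, which for the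
positive semidefinite symmetric matrix `M Mᵀ` is equivalent to the spectral norm bound),
then the primal–dual iterates
`Ē^{k+1} = X − Mᵀ Y^k`, `Ȳ^{k+1} = Y^k + (1/2) M Ē^{k+1}`,
`Y^{k+1} = sign(Ȳ^{k+1}) ⊙ min(|Ȳ^{k+1}|, λ)` (entrywise), `E^{k+1} = X − Mᵀ Y^{k+1}`
converge to the unique global minimizer of
`F(E) = (1/2)‖E − X‖_F² + λ‖M E‖₁`. -/
theorem gtcf_convergence
    (m n d : ℕ) (hm : 0 < m) (hn : 0 < n) (hd : 0 < d)
    (M : Matrix (Fin m) (Fin n) ℝ)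
    (hM : ∀ x : Fin m → ℝ, x ⬝ᵥ ((M * Mᵀ).mulVec x) ≤ 2 * (x ⬝ᵥ x))
    (X : Matrix (Fin n) (Fin d) ℝ) (lam : ℝ) (hlam : 0 ≤ lam)
    (F : Matrix (Fin n) (Fin d) ℝ → ℝ)
    (hF : ∀ E, F E = (1 / 2) * (∑ i, ∑ j, (E i j - X i j) ^ 2) +
        lam * (∑ i, ∑ j, |(M * E) i j|))
    (Y Ybar : ℕ → Matrix (Fin m) (Fin d) ℝ)
    (E Ebar : ℕ → Matrix (Fin n) (Fin d) ℝ)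
    (hEbar : ∀ k : ℕ, Ebar (k + 1) = X - Mᵀ * Y k)
    (hYbar : ∀ k : ℕ, Ybar (k + 1) = Y k + (1 / 2 : ℝ) • (M * Ebar (k + 1)))
    (hY : ∀ (k : ℕ) (i : Fin m) (j : Fin d),
      Y (k + 1) i j = Real.sign (Ybar (k + 1) i j) * min |Ybar (k + 1) i j| lam)
    (hE : ∀ k : ℕ, E (k + 1) = X - Mᵀ * Y (k + 1)) :
    ∃ Estar : Matrix (Fin n) (Fin d) ℝ,
      (∀ E', F Estar ≤ F E') ∧
      (∀ E'' : Matrix (Fin n) (Fin d) ℝ, (∀ E', F E'' ≤ F E') → E'' = Estar) ∧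
      Tendsto E atTop (nhds Estar) := by
  obtain ⟨S, hS, hvar⟩ := exists_dual_solution M X hlam
  have hF' : ∀ A, F A = 1 / 2 * frobInner (A - X) (A - X) + lam * ∑ i, ∑ j, |(M * A) i j| :=
    fun A => by simp only [hF, frobInner, Matrix.sub_apply, sq]
  have hgrowth : ∀ A, F (X - Mᵀ * S) +
      1 / 2 * frobInner (A - (X - Mᵀ * S)) (A - (X - Mᵀ * S)) ≤ F A := fun A => by
    rw [hF', hF']
    exact primal_quadratic_growth M X hlam hS rfl hvar A
  refine ⟨X - Mᵀ * S, fun A => ?_, fun A hA => ?_, ?_⟩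
  · linarith [hgrowth A, frobInner_self_nonneg (A - (X - Mᵀ * S))]
  · ext i j
    have h := sq_apply_le_frobInner_self (A - (X - Mᵀ * S)) i j
    have h0 : (A - (X - Mᵀ * S)) i j ^ 2 = 0 :=
      le_antisymm (by linarith [hgrowth A, hA (X - Mᵀ * S)]) (sq_nonneg _)
    exact sub_eq_zero.1 (pow_eq_zero_iff two_ne_zero |>.1 h0)
  have hstep : ∀ k, frobInner (Y (k + 1) - S) (Y (k + 1) - S) +
      1 / 2 * frobInner (E (k + 1) - (X - Mᵀ * S)) (E (k + 1) - (X - Mᵀ * S)) ≤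
      frobInner (Y k - S) (Y k - S) := fun k => by
    rw [hE k]
    refine dual_step_descent M hM X ?_ (hvar _ fun i j => ?_)
    · rw [← hEbar, ← hYbar]
      refine Finset.sum_nonpos fun i _ => Finset.sum_nonpos fun j _ => ?_
      simp only [Matrix.sub_apply, hY]
      exact sub_sign_mul_min_mul_nonpos (hS i j) _
    · rw [hY]
      exact abs_sign_mul_min_le hlam _
  have hlim := tendsto_zero_of_add_le (D := fun k => frobInner (Y k - S) (Y k - S))
    (fun k => frobInner_self_nonneg _)
    (fun k => mul_nonneg one_half_pos.le (frobInner_self_nonneg _)) hstep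
  refine (tendsto_add_atTop_iff_nat 1).1 (tendsto_pi_nhds.2 fun i => tendsto_pi_nhds.2 fun j => ?_)
  have hsq : Tendsto (fun k => (E (k + 1) i j - (X - Mᵀ * S) i j) ^ 2) atTop (nhds 0) := by
    refine squeeze_zero (fun k => sq_nonneg _) (fun k => ?_) (by simpa using hlim.const_mul 2)
    have h := sq_apply_le_frobInner_self (E (k + 1) - (X - Mᵀ * S)) i j
    rw [Matrix.sub_apply] at h
    linarith
  have habs := (Real.continuous_sqrt.tendsto 0).comp hsq
  simp only [Function.comp_def, Real.sqrt_sq_eq_abs, Real.sqrt_zero] at habs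
  exact tendsto_sub_nhds_zero_iff.1 ((tendsto_zero_iff_abs_tendsto_zero _).2 habs)
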